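/- Let d ≥ 1 and let ρ be a density matrix on ℂ^d. Then sInf{ Tr(σ) | σ is a d×d positive semidefinite matrix such that Δ(σ) − ρ is positive semidefinite } = sSup{ Tr(ρ τ) | τ is a d×d positive semidefinite matrix with Δ(τ) = I }. (Semidefinite programming duality for the max-relative entropy of coherence.) -/

import Mathlib

open Matrix ComplexOrder

section
variable {n : Type*} [Fintype n]

open scoped MatrixOrder in
theorem exists_eq_conjTranspose_mul_self {A : Matrix n n ℂ} (hA : A.PosSemidef) :
    ∃ B : Matrix n n ℂ, A = Bᴴ * B := by
  classical
  exact CStarAlgebra.nonneg_iff_eq_star_mul_self.mp hA.nonneg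

theorem trace_mul_nonneg_of_posSemidef {A B : Matrix n n ℂ} (hA : A.PosSemidef)
    (hB : B.PosSemidef) : 0 ≤ (A * B).trace := by
  obtain ⟨C, rfl⟩ := exists_eq_conjTranspose_mul_self hA
  rw [← trace_mul_cycle]
  exact (hB.mul_mul_conjTranspose_same C).trace_nonneg

theorem trace_conjTranspose_mul_self_eq_sum_normSq (B : Matrix n n ℂ) :
    (Bᴴ * B).trace = ((∑ i, ∑ j, Complex.normSq (B j i) : ℝ) : ℂ) := by
  simp [trace, mul_apply, Complex.normSq_eq_conj_mul_self]

theorem trace_diagonal_mul_re [DecidableEq n] (s : n → ℝ) (τ : Matrix n n ℂ) :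
    (diagonal (fun i => (s i : ℂ)) * τ).trace.re = ∑ i, s i * (τ i i).re := by
  simp [trace, diagonal_mul]

/-- The positive semidefinite matrices of trace `r`. -/
def posSemidefOfTrace (n : Type*) [Fintype n] (r : ℝ) : Set (Matrix n n ℂ) :=
  {τ | τ.PosSemidef ∧ τ.trace = r}

theorem convex_posSemidefOfTrace (r : ℝ) : Convex ℝ (posSemidefOfTrace n r) := by
  rintro x ⟨hx, hxr⟩ y ⟨hy, hyr⟩ a b ha hb hab
  refine ⟨(hx.smul ha).add (hy.smul hb), ?_⟩
  rw [trace_add, trace_smul, trace_smul, hxr, hyr, ← add_smul, hab, one_smul]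

theorem isCompact_posSemidefOfTrace (r : ℝ) : IsCompact (posSemidefOfTrace n r) := by
  let K : Set (Matrix n n ℂ) := {B | ∑ i, ∑ j, Complex.normSq (B j i) = r}
  have hball : IsCompact (Set.pi Set.univ fun _ : n => Set.pi Set.univ fun _ : n =>
      Metric.closedBall (0 : ℂ) (Real.sqrt r)) :=
    isCompact_univ_pi fun _ => isCompact_univ_pi fun _ => isCompact_closedBall _ _
  have hK : IsCompact K := by
    refine hball.of_isClosed_subset (isClosed_eq ?_ continuous_const) ?_
    · exact continuous_finsetSum _ fun i _ => continuous_finsetSum _ fun j _ =>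
        Complex.continuous_normSq.comp (continuous_id.matrix_elem j i)
    · intro B hB j _ i _
      rw [mem_closedBall_zero_iff]
      refine Real.le_sqrt_of_sq_le ?_
      rw [← Complex.normSq_eq_norm_sq, ← show _ = r from hB]
      exact (Finset.single_le_sum (f := fun j => Complex.normSq (B j i))
          (fun _ _ => Complex.normSq_nonneg _) (Finset.mem_univ j)).trans
        (Finset.single_le_sum (f := fun i => ∑ j, Complex.normSq (B j i))
          (fun _ _ => Finset.sum_nonneg fun _ _ => Complex.normSq_nonneg _) (Finset.mem_univ i))
  convert hK.image (f := fun B : Matrix n n ℂ => Bᴴ * B) (by fun_prop) using 1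
  ext τ
  constructor
  · rintro ⟨hτ, hr⟩
    obtain ⟨B, rfl⟩ := exists_eq_conjTranspose_mul_self hτ
    rw [trace_conjTranspose_mul_self_eq_sum_normSq] at hr
    exact ⟨B, Complex.ofReal_injective hr, rfl⟩
  · rintro ⟨B, hB, rfl⟩
    refine ⟨posSemidef_conjTranspose_mul_self B, ?_⟩
    rw [trace_conjTranspose_mul_self_eq_sum_normSq, show _ = r from hB]

theorem posSemidef_of_trace_mul_nonneg {A : Matrix n n ℂ} (hA : A.IsHermitian) {r : ℝ}
    (hr : 0 < r) (h : ∀ τ ∈ posSemidefOfTrace n r, 0 ≤ (A * τ).trace.re) : A.PosSemidef := by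
  refine .of_dotProduct_mulVec_nonneg hA fun x => ?_
  rw [Complex.nonneg_iff]
  refine ⟨?_, (hA.im_star_dotProduct_mulVec_self x).symm⟩
  rcases eq_or_ne x 0 with rfl | hx
  · simp
  have hN : 0 < x ⬝ᵥ star x := dotProduct_comm x (star x) ▸ dotProduct_star_self_pos_iff.2 hx
  obtain ⟨hre, him⟩ := Complex.pos_iff.1 hN
  set N := (x ⬝ᵥ star x).re with hNdef
  have hNeq : x ⬝ᵥ star x = N := Complex.ext rfl him.symm
  have key := h ((r / N) • vecMulVec x (star x))
    ⟨(posSemidef_vecMulVec_self_star x).smul (by positivity), by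
      rw [trace_smul, trace_vecMulVec, hNeq, Complex.real_smul, ← Complex.ofReal_mul,
        div_mul_cancel₀ _ hre.ne']⟩
  rw [Matrix.mul_smul, trace_smul, mul_vecMulVec, trace_vecMulVec, dotProduct_comm,
    Complex.smul_re, smul_eq_mul] at key
  exact nonneg_of_mul_nonneg_right key (by positivity)

theorem trace_mul_re_le_of_posSemidef_sub [DecidableEq n] {ρ σ τ : Matrix n n ℂ}
    (hσ : (diagonal (fun i => σ i i) - ρ).PosSemidef) (hτ : τ.PosSemidef)
    (hτ1 : ∀ i, τ i i = 1) : (ρ * τ).trace.re ≤ σ.trace.re := by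
  have h := (Complex.nonneg_iff.1 (trace_mul_nonneg_of_posSemidef hσ hτ)).1
  have hd : (diagonal (fun i => σ i i) * τ).trace = σ.trace := by
    simp [trace, diagonal_mul, hτ1]
  rw [Matrix.sub_mul, trace_sub, hd, Complex.sub_re] at h
  linarith

/-- The diagonal of `τ` paired with `Re Tr(ρτ)`. -/
noncomputable def diagTraceMul (ρ : Matrix n n ℂ) : Matrix n n ℂ →ₗ[ℝ] (n → ℝ) × ℝ where
  toFun τ := (fun i => (τ i i).re, (ρ * τ).trace.re)
  map_add' x y := by
    ext <;> simp [Matrix.mul_add]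
  map_smul' a x := by
    ext <;> simp

theorem continuous_diagTraceMul (ρ : Matrix n n ℂ) : Continuous (diagTraceMul ρ) :=
  LinearMap.continuous_of_finiteDimensional _

theorem mem_posSemidefOfTrace_card {τ : Matrix n n ℂ} (hτ : τ.PosSemidef) (h : ∀ i, τ i i = 1) :
    τ ∈ posSemidefOfTrace n (Fintype.card n : ℝ) :=
  ⟨hτ, by simp [trace, h]⟩

theorem bddAbove_trace_mul (ρ : Matrix n n ℂ) :
    BddAbove {x : ℝ | ∃ τ : Matrix n n ℂ,
      τ.PosSemidef ∧ (∀ i, τ i i = 1) ∧ x = (ρ * τ).trace.re} := by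
  refine ((isCompact_posSemidefOfTrace (n := n) (Fintype.card n : ℝ)).image
    (continuous_snd.comp (continuous_diagTraceMul ρ))).bddAbove.mono ?_
  rintro x ⟨τ, hτ, h1, hx⟩
  exact ⟨τ, mem_posSemidefOfTrace_card hτ h1, hx.symm⟩

theorem exists_diagonal_sub_posSemidef [DecidableEq n] [Nonempty n] {ρ : Matrix n n ℂ}
    (hρ : ρ.IsHermitian) {t : ℝ}
    (ht : ∀ τ : Matrix n n ℂ, τ.PosSemidef → (∀ i, τ i i = 1) → (ρ * τ).trace.re < t) :
    ∃ s : n → ℝ, (diagonal (fun i => (s i : ℂ)) - ρ).PosSemidef ∧ ∑ i, s i = t := by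
  obtain ⟨r, hr⟩ : ∃ r : ℝ, r = Fintype.card n := ⟨_, rfl⟩
  have hr0 : 0 < r := by rw [hr]; positivity
  let R : Set ((n → ℝ) × ℝ) := {1} ×ˢ Set.Ici t
  have hdisj : Disjoint (diagTraceMul ρ '' posSemidefOfTrace n r) R := by
    rw [Set.disjoint_left]
    rintro _ ⟨τ, ⟨hτ, -⟩, rfl⟩ ⟨h1, h2⟩
    refine (ht τ hτ fun i => Complex.ext (congrFun h1 i) ?_).not_ge h2
    exact (Complex.nonneg_iff.1 hτ.diag_nonneg).2.symm
  obtain ⟨φ, u, w, hu, huw, hw⟩ := geometric_hahn_banach_compact_closed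
    ((convex_posSemidefOfTrace r).linear_image (diagTraceMul ρ))
    ((isCompact_posSemidefOfTrace r).image (continuous_diagTraceMul ρ))
    ((convex_singleton 1).prod (convex_Ici t)) (isClosed_singleton.prod isClosed_Ici) hdisj
  set c : ℝ := φ (0, 1) with hc
  set y : n → ℝ := fun i => φ (Pi.single i 1, 0) with hy
  have hφ (a : n → ℝ) (b : ℝ) : φ (a, b) = ∑ i, a i * y i + b * c := by
    have h1 : (a, b) = ∑ i, a i • ((Pi.single i 1, 0) : (n → ℝ) × ℝ) + b • (0, 1) := by
      ext j <;> simp [Prod.fst_sum, Prod.snd_sum, Finset.sum_apply, Pi.single_apply]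
    rw [h1, map_add, map_sum]
    simp only [map_smul, smul_eq_mul, hy, hc]
  have hsep (τ) (hτ : τ ∈ posSemidefOfTrace n r) :
      ∑ i, (τ i i).re * y i + (ρ * τ).trace.re * c < ∑ i, y i + t * c := by
    have h1 := hu _ ⟨τ, hτ, rfl⟩
    have h2 := hw (1, t) ⟨rfl, Set.self_mem_Ici⟩
    rw [hφ] at h2
    change φ (_, _) < u at h1
    rw [hφ] at h1
    simp only [Pi.one_apply, one_mul] at h2
    linarith
  have hc0 : 0 < c := by
    have h1 := hsep 1 (hr ▸ mem_posSemidefOfTrace_card .one (by simp))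
    have h2 := ht 1 .one (by simp)
    simp only [one_apply_eq, Complex.one_re, one_mul] at h1
    nlinarith
  refine ⟨fun i => ((∑ j, y j) / c + t) / r - y i / c, ?_, ?_⟩
  · refine posSemidef_of_trace_mul_nonneg (r := r) ?_ hr0 fun τ hτ => ?_
    · exact (isHermitian_diagonal_of_self_adjoint _ (by ext; simp)).sub hρ
    rw [Matrix.sub_mul, trace_sub, Complex.sub_re, trace_diagonal_mul_re]
    have hsum : ∑ i, (τ i i).re = r := by
      simpa [trace] using congrArg Complex.re hτ.2
    have h1 : ∑ i, (((∑ j, y j) / c + t) / r - y i / c) * (τ i i).re =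
        (∑ j, y j) / c + t - (∑ i, (τ i i).re * y i) / c := by
      simp only [sub_mul, Finset.sum_sub_distrib, ← Finset.mul_sum, hsum]
      rw [div_mul_cancel₀ _ hr0.ne', Finset.sum_div _ fun i => (τ i i).re * y i]
      exact congrArg _ (Finset.sum_congr rfl fun i _ => by ring)
    rw [h1]
    have h2 := hsep τ hτ
    have h3 : (∑ j, y j) / c + t - (∑ i, (τ i i).re * y i) / c - (ρ * τ).trace.re =
        (∑ i, y i + t * c - (∑ i, (τ i i).re * y i + (ρ * τ).trace.re * c)) / c := by
      field_simp
      ring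
    rw [h3]
    exact div_nonneg (by linarith) hc0.le
  · rw [Finset.sum_sub_distrib, Finset.sum_const, Finset.card_univ, nsmul_eq_mul, ← hr,
      mul_div_cancel₀ _ hr0.ne', ← Finset.sum_div]
    ring

end

/-- SDP duality,
`min{Tr σ : σ ≥ 0, Δ(σ) ≥ ρ} = max{Tr(ρτ) : τ ≥ 0, Δ(τ) = I}`. -/
theorem stmt2 (d : ℕ) (hd : 1 ≤ d) (ρ : Matrix (Fin d) (Fin d) ℂ)
    (hρ : ρ.PosSemidef) (hρtr : ρ.trace = 1) :
    sInf {x : ℝ | ∃ σ : Matrix (Fin d) (Fin d) ℂ,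
        σ.PosSemidef ∧ (Matrix.diagonal (fun i => σ i i) - ρ).PosSemidef ∧
        x = σ.trace.re} =
    sSup {x : ℝ | ∃ τ : Matrix (Fin d) (Fin d) ℂ,
        τ.PosSemidef ∧ (∀ i, τ i i = 1) ∧ x = (ρ * τ).trace.re} := by
  have : Nonempty (Fin d) := ⟨⟨0, hd⟩⟩
  have hbdd := bddAbove_trace_mul ρ
  set P := {x : ℝ | ∃ σ : Matrix (Fin d) (Fin d) ℂ,
    σ.PosSemidef ∧ (Matrix.diagonal (fun i => σ i i) - ρ).PosSemidef ∧ x = σ.trace.re}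
  set D := {x : ℝ | ∃ τ : Matrix (Fin d) (Fin d) ℂ,
    τ.PosSemidef ∧ (∀ i, τ i i = 1) ∧ x = (ρ * τ).trace.re}
  have hstrong (ε : ℝ) (hε : 0 < ε) : sSup D + ε ∈ P := by
    obtain ⟨s, hs, hsum⟩ := exists_diagonal_sub_posSemidef (t := sSup D + ε) hρ.isHermitian
      fun τ hτ h1 => (le_csSup hbdd ⟨τ, hτ, h1, rfl⟩).trans_lt (lt_add_of_pos_right _ hε)
    refine ⟨diagonal fun i => (s i : ℂ), ?_, by simpa using hs, ?_⟩
    · simpa using hs.add hρ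
    · simp [trace_diagonal, ← hsum]
  have hweak : ∀ p ∈ P, ∀ q ∈ D, q ≤ p := by
    rintro _ ⟨σ, -, hσ, rfl⟩ _ ⟨τ, hτ, h1, rfl⟩
    exact trace_mul_re_le_of_posSemidef_sub hσ hτ h1
  have hD : D.Nonempty := ⟨_, 1, .one, by simp, rfl⟩
  apply le_antisymm
  · refine le_of_forall_pos_le_add fun ε hε => csInf_le ?_ (hstrong ε hε)
    exact ⟨hD.some, fun p hp => hweak p hp _ hD.some_mem⟩
  · exact le_csInf ⟨_, hstrong 1 one_pos⟩ fun p hp => csSup_le hD fun q hq => hweak p hp q hq
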